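/- Fix integers d ≥ 2 and N ≥ 1, a traceless Hermitian matrix h ∈ M_d(ℂ), and a density matrix ρ ∈ M_{d^N}(ℂ) with eigenvalues (p_j). Then E_{U∼μ(d^N)} F(UρU†, H_N) = (4N·tr(h²)/d)·(d^N/(d^N+1))·Λ(p), where Λ(p) := (1/(2(d^N−1)))·Σ_{i,j : p_i+p_j ≠ 0} (p_i−p_j)²/(p_i+p_j). -/

import Mathlib

open MeasureTheory Matrix
open scoped ComplexOrder

noncomputable section

namespace Paper

instance matrixMeasurableSpace {m n : Type*} : MeasurableSpace (Matrix m n ℂ) :=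
  (inferInstance : MeasurableSpace (m → n → ℂ))

/-- The quantum Fisher information of a state `ρ` with Hamiltonian `H`. -/
def QFI {n : Type*} [Fintype n] [DecidableEq n] (ρ H : Matrix n n ℂ) : ℝ :=
  if hρ : ρ.IsHermitian then
    2 * ∑ j, ∑ k,
      if hρ.eigenvalues j + hρ.eigenvalues k = 0 then 0
      else ((hρ.eigenvalues j - hρ.eigenvalues k) ^ 2 / (hρ.eigenvalues j + hρ.eigenvalues k)) *
        ‖star (fun i => (hρ.eigenvectorUnitary : Matrix n n ℂ) i j) ⬝ᵥ
          (H *ᵥ fun i => (hρ.eigenvectorUnitary : Matrix n n ℂ) i k)‖ ^ 2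
  else 0

/-- The Hamiltonian `H_N = Σ_j h^{(j)}` on `N` particles, acting as `h` on the `j`-th
tensor factor and as the identity on the others. -/
def localHam (d N : ℕ) (h : Matrix (Fin d) (Fin d) ℂ) :
    Matrix (Fin N → Fin d) (Fin N → Fin d) ℂ :=
  ∑ j : Fin N, Matrix.of fun x y =>
    if ∀ i, i ≠ j → x i = y i then h (x j) (y j) else 0

section LocalHamiltonian

variable {N d : ℕ}

/-- The tensor product of a family of matrices. -/
def tensorFamily (M : Fin N → Matrix (Fin d) (Fin d) ℂ) :
    Matrix (Fin N → Fin d) (Fin N → Fin d) ℂ :=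
  Matrix.of fun x y => ∏ k, M k (x k) (y k)

lemma tensorFamily_mul (M M' : Fin N → Matrix (Fin d) (Fin d) ℂ) :
    tensorFamily M * tensorFamily M' = tensorFamily (M * M') := by
  ext x y
  simp only [tensorFamily, Matrix.mul_apply, of_apply, Pi.mul_apply, Finset.prod_univ_sum,
    Fintype.piFinset_univ, Finset.prod_mul_distrib]

lemma trace_tensorFamily (M : Fin N → Matrix (Fin d) (Fin d) ℂ) :
    (tensorFamily M).trace = ∏ k, (M k).trace := by
  simp only [tensorFamily, Matrix.trace, diag_apply, of_apply, Finset.prod_univ_sum,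
    Fintype.piFinset_univ]

lemma localHam_eq_sum_tensorFamily (h : Matrix (Fin d) (Fin d) ℂ) :
    localHam d N h = ∑ j, tensorFamily (Function.update 1 j h) := by
  refine Finset.sum_congr rfl fun j _ => ?_
  ext x y
  simp only [tensorFamily, of_apply]
  rw [← Finset.mul_prod_erase _ _ (Finset.mem_univ j), Function.update_self]
  have : ∀ k ∈ Finset.univ.erase j,
      (Function.update (1 : Fin N → Matrix (Fin d) (Fin d) ℂ) j h) k (x k) (y k)
        = if x k = y k then 1 else 0 := by
    intro k hk
    rw [Function.update_of_ne (Finset.ne_of_mem_erase hk), Pi.one_apply, Matrix.one_apply]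
  rw [Finset.prod_congr rfl this, Finset.prod_ite_zero]
  simp

lemma trace_localHam {h : Matrix (Fin d) (Fin d) ℂ} (htr : h.trace = 0) :
    (localHam d N h).trace = 0 := by
  rw [localHam_eq_sum_tensorFamily, trace_sum]
  refine Finset.sum_eq_zero fun j _ => ?_
  rw [trace_tensorFamily]
  exact Finset.prod_eq_zero (Finset.mem_univ j) (by simpa using htr)

lemma trace_localHam_mul_self {h : Matrix (Fin d) (Fin d) ℂ} (htr : h.trace = 0) :
    (localHam d N h * localHam d N h).trace = N * (d ^ (N - 1) * (h * h).trace) := by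
  have key : ∀ i j : Fin N, (tensorFamily (Function.update 1 i h) *
      tensorFamily (Function.update 1 j h)).trace =
        if i = j then (d : ℂ) ^ (N - 1) * (h * h).trace else 0 := by
    intro i j
    rw [tensorFamily_mul, trace_tensorFamily, ← Finset.mul_prod_erase _ _ (Finset.mem_univ i)]
    split_ifs with hij
    · subst hij
      have : ∀ k ∈ Finset.univ.erase i,
          ((Function.update (1 : Fin N → Matrix (Fin d) (Fin d) ℂ) i h *
            Function.update (1 : Fin N → Matrix (Fin d) (Fin d) ℂ) i h) k).trace = d := by
        intro k hk
        simp [Function.update_of_ne (Finset.ne_of_mem_erase hk)]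
      rw [Finset.prod_congr rfl this]
      simp [mul_comm]
    · simp [Function.update_of_ne hij, htr]
  rw [localHam_eq_sum_tensorFamily, Finset.sum_mul, trace_sum]
  simp_rw [Finset.mul_sum, trace_sum, key]
  simp

lemma isHermitian_localHam {h : Matrix (Fin d) (Fin d) ℂ} (hh : h.IsHermitian) :
    (localHam d N h).IsHermitian := by
  rw [localHam, Matrix.IsHermitian, conjTranspose_sum]
  refine Finset.sum_congr rfl fun j _ => ?_
  ext x y
  simp only [conjTranspose_apply, of_apply, apply_ite star, star_zero, hh.apply, eq_comm]

end LocalHamiltonian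

section FisherInformation

variable {n : Type*} [Fintype n] [DecidableEq n]

/-- The weight `(x - y)² / (x + y)` of a pair of eigenvalues, zero when `x + y = 0`. -/
def qfiWeight (x y : ℝ) : ℝ := if x + y = 0 then 0 else (x - y) ^ 2 / (x + y)

lemma qfiWeight_self (x : ℝ) : qfiWeight x x = 0 := by simp [qfiWeight]

omit [DecidableEq n] in
lemma trace_weighted_mul_conjTranspose (c : n → n → ℝ) (M : Matrix n n ℂ) :
    ((Matrix.of fun j k => (c j k : ℂ) * M j k) * Mᴴ).trace =
      ((∑ j, ∑ k, c j k * ‖M j k‖ ^ 2 : ℝ) : ℂ) := by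
  push_cast
  simp only [Matrix.trace, diag_apply, Matrix.mul_apply, of_apply, conjTranspose_apply]
  refine Finset.sum_congr rfl fun j _ => Finset.sum_congr rfl fun k _ => ?_
  rw [mul_assoc, ← Complex.mul_conj']
  rfl

/-- A weighted sum of squared matrix elements in an eigenbasis does not depend on the
eigenbasis. -/
lemma sum_weight_eq_of_diagonal_conj (f : ℝ → ℝ → ℝ) {p q : n → ℝ} {T M : Matrix n n ℂ}
    (hT : star T * T = 1)
    (hpq : diagonal (fun i => (p i : ℂ)) * T = T * diagonal (fun i => (q i : ℂ))) :
    ∑ j, ∑ k, f (q j) (q k) * ‖(star T * M * T) j k‖ ^ 2 =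
      ∑ j, ∑ k, f (p j) (p k) * ‖M j k‖ ^ 2 := by
  have hT' : T * star T = 1 := mul_eq_one_comm.mp hT
  have hp : ∀ a j, T a j ≠ 0 → p a = q j := by
    intro a j h
    have := congrFun (congrFun hpq a) j
    rw [diagonal_mul, mul_diagonal, mul_comm] at this
    exact_mod_cast mul_left_cancel₀ h this
  have hF : (Matrix.of fun j k => (f (q j) (q k) : ℂ) * (star T * M * T) j k) =
      star T * (Matrix.of fun j k => (f (p j) (p k) : ℂ) * M j k) * T := by
    ext j k
    simp only [Matrix.mul_apply, of_apply, star_apply, Finset.mul_sum, Finset.sum_mul]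
    refine Finset.sum_congr rfl fun b _ => Finset.sum_congr rfl fun a _ => ?_
    by_cases ha : T a j = 0
    · simp [ha]
    by_cases hb : T b k = 0
    · simp [hb]
    rw [hp a j ha, hp b k hb]
    ring
  have h1 := trace_weighted_mul_conjTranspose (fun j k => f (q j) (q k)) (star T * M * T)
  rw [hF] at h1
  have h2 := trace_weighted_mul_conjTranspose (fun j k => f (p j) (p k)) M
  rw [← Complex.ofReal_inj, ← h1, ← h2]
  set F : Matrix n n ℂ := Matrix.of fun j k => (f (p j) (p k) : ℂ) * M j k
  have e : (star T * M * T)ᴴ = star T * Mᴴ * T := by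
    simp [← star_eq_conjTranspose, star_mul, mul_assoc]
  calc (star T * F * T * (star T * M * T)ᴴ).trace
      = (star T * (F * (T * star T) * Mᴴ * T)).trace := by rw [e]; simp only [mul_assoc]
    _ = (F * Mᴴ * (T * star T)).trace := by
        rw [trace_mul_comm, hT']; simp only [mul_assoc, mul_one, hT']
    _ = (F * Mᴴ).trace := by rw [hT', mul_one]

lemma QFI_eq_sum_of_eq_conj_diagonal {ρ V : Matrix n n ℂ} (H : Matrix n n ℂ) {p : n → ℝ}
    (hV : star V * V = 1) (hρ : ρ = V * diagonal (fun i => (p i : ℂ)) * star V) :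
    QFI ρ H = 2 * ∑ j, ∑ k, qfiWeight (p j) (p k) * ‖(star V * H * V) j k‖ ^ 2 := by
  have hV' : V * star V = 1 := mul_eq_one_comm.mp hV
  have hherm : ρ.IsHermitian := by
    rw [hρ]
    refine isHermitian_mul_mul_conjTranspose V ?_
    rw [isHermitian_diagonal_iff]
    intro i
    simp [IsSelfAdjoint]
  set W : Matrix n n ℂ := hherm.eigenvectorUnitary.1 with hW
  have hWW : star W * W = 1 := mem_unitaryGroup_iff'.mp hherm.eigenvectorUnitary.2
  have hspec : ρ = W * diagonal (fun i => (hherm.eigenvalues i : ℂ)) * star W := by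
    conv_lhs => rw [hherm.spectral_theorem, Unitary.conjStarAlgAut_apply]
    rfl
  have hT : star (star V * W) * (star V * W) = 1 := by
    rw [star_mul, star_star]
    calc star W * V * (star V * W) = star W * (V * star V) * W := by simp only [mul_assoc]
      _ = 1 := by rw [hV', mul_one, hWW]
  have hpq : diagonal (fun i => (p i : ℂ)) * (star V * W) =
      star V * W * diagonal (fun i => (hherm.eigenvalues i : ℂ)) := by
    calc diagonal (fun i => (p i : ℂ)) * (star V * W)
        = (star V * V) * diagonal (fun i => (p i : ℂ)) * (star V * W) := by rw [hV, one_mul]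
      _ = star V * (V * diagonal (fun i => (p i : ℂ)) * star V) * W := by simp only [mul_assoc]
      _ = star V * (W * diagonal (fun i => (hherm.eigenvalues i : ℂ)) * star W) * W := by
          rw [← hρ, ← hspec]
      _ = star V * W * diagonal (fun i => (hherm.eigenvalues i : ℂ)) * (star W * W) := by
          simp only [mul_assoc]
      _ = _ := by rw [hWW, mul_one]
  have hM : star (star V * W) * (star V * H * V) * (star V * W) = star W * H * W := by
    rw [star_mul, star_star]
    calc star W * V * (star V * H * V) * (star V * W)
        = star W * (V * star V) * H * (V * star V) * W := by simp only [mul_assoc]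
      _ = _ := by rw [hV', mul_one, mul_one]
  rw [← sum_weight_eq_of_diagonal_conj qfiWeight hT hpq, hM, QFI, dif_pos hherm]
  congr 1
  refine Finset.sum_congr rfl fun j _ => Finset.sum_congr rfl fun k _ => ?_
  rw [qfiWeight, ite_mul, zero_mul]
  congr 4
  rw [mul_assoc]
  simp only [Matrix.mul_apply, dotProduct, mulVec, star_apply, Pi.star_apply, ← hW]

end FisherInformation

section HaarAverage

variable {n : Type*} [Fintype n] [DecidableEq n]

instance matrixBorelSpace : BorelSpace (Matrix n n ℂ) :=
  inferInstanceAs (BorelSpace (n → n → ℂ))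

lemma integrable_continuous_comp_coe (μ : Measure (specialUnitaryGroup n ℂ))
    [IsProbabilityMeasure μ] {f : Matrix n n ℂ → ℂ} (hf : Continuous f) :
    Integrable (fun U : specialUnitaryGroup n ℂ => f U.1) μ := by
  have hK : IsCompact (Set.univ.pi fun _ : n => Set.univ.pi fun _ : n =>
      Metric.closedBall (0 : ℂ) 1) :=
    isCompact_univ_pi fun _ => isCompact_univ_pi fun _ => isCompact_closedBall 0 1
  obtain ⟨C, hC⟩ := hK.exists_bound_of_continuousOn (f := f) hf.continuousOn
  refine Integrable.of_bound
    (hf.measurable.comp measurable_subtype_coe).aestronglyMeasurable C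
    (Filter.Eventually.of_forall fun U => hC U.1 ?_)
  intro i _ j _
  simpa using entry_norm_bound_of_unitary U.2.1 i j

omit [DecidableEq n] in
lemma continuous_mul_star_matrixElement (W : Matrix n n ℂ) (j k : n) (A A' : Matrix n n ℂ) :
    Continuous fun U : Matrix n n ℂ => (star (U * W) * A * (U * W)) j k *
      star ((star (U * W) * A' * (U * W)) j k) := by
  have h : ∀ A : Matrix n n ℂ, Continuous fun U : Matrix n n ℂ =>
      (star (U * W) * A * (U * W)) j k := fun A => Continuous.matrix_elem (by fun_prop) j k
  exact (h A).mul (h A').star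

/-- The Haar average of the product of the matrix element of `A` and the conjugate matrix
element of `A'` between the `j`-th and `k`-th columns of `U * W`. -/
def haarCorr (μ : Measure (specialUnitaryGroup n ℂ)) (W : Matrix n n ℂ) (j k : n)
    (A A' : Matrix n n ℂ) : ℂ :=
  ∫ U, (star (U.1 * W) * A * (U.1 * W)) j k *
    star ((star (U.1 * W) * A' * (U.1 * W)) j k) ∂μ

variable {μ : Measure (specialUnitaryGroup n ℂ)} {W : Matrix n n ℂ} {j k : n}

lemma integrable_haarCorr [IsProbabilityMeasure μ] (A A' : Matrix n n ℂ) :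
    Integrable (fun U : specialUnitaryGroup n ℂ => (star (U.1 * W) * A * (U.1 * W)) j k *
      star ((star (U.1 * W) * A' * (U.1 * W)) j k)) μ := by
  exact integrable_continuous_comp_coe μ (f := fun U => (star (U * W) * A * (U * W)) j k *
    star ((star (U * W) * A' * (U * W)) j k)) (continuous_mul_star_matrixElement W j k A A')

lemma haarCorr_conj_symm (A A' : Matrix n n ℂ) :
    haarCorr μ W j k A' A = star (haarCorr μ W j k A A') := by
  rw [haarCorr, haarCorr, Complex.star_def, ← integral_conj]
  congr 1
  ext U
  simp [mul_comm]

lemma haarCorr_sum_left [IsProbabilityMeasure μ] {ι : Type*} (s : Finset ι) (c : ι → ℂ)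
    (A : ι → Matrix n n ℂ) (A' : Matrix n n ℂ) :
    haarCorr μ W j k (∑ i ∈ s, c i • A i) A' = ∑ i ∈ s, c i * haarCorr μ W j k (A i) A' := by
  simp only [haarCorr]
  simp_rw [← integral_const_mul]
  rw [← integral_finsetSum _ fun i _ => (integrable_haarCorr _ _).const_mul _]
  congr 1
  ext U
  simp only [Finset.mul_sum, Finset.sum_mul, Matrix.sum_apply, Matrix.mul_smul, Matrix.smul_mul,
    Matrix.smul_apply, smul_eq_mul, mul_assoc]

lemma haarCorr_sum_right [IsProbabilityMeasure μ] {ι : Type*} (s : Finset ι) (c : ι → ℂ)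
    (A : ι → Matrix n n ℂ) (A' : Matrix n n ℂ) :
    haarCorr μ W j k A' (∑ i ∈ s, c i • A i) =
      ∑ i ∈ s, star (c i) * haarCorr μ W j k A' (A i) := by
  rw [haarCorr_conj_symm, haarCorr_sum_left, star_sum]
  refine Finset.sum_congr rfl fun i _ => ?_
  rw [star_mul', ← haarCorr_conj_symm]

lemma exists_smul_mem_specialUnitaryGroup {g : Matrix n n ℂ} (hg : g ∈ unitaryGroup n ℂ) :
    ∃ z : ℂ, star z * z = 1 ∧ z • g ∈ specialUnitaryGroup n ℂ := by
  rcases isEmpty_or_nonempty n with hn | hn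
  · refine ⟨1, by simp, ?_⟩
    rw [one_smul]
    exact mem_specialUnitaryGroup_iff.mpr ⟨hg, by simp⟩
  have hdet : ‖g.det‖ = 1 :=
    CStarRing.norm_of_mem_unitary (det_of_mem_unitary hg)
  obtain ⟨w, hw⟩ := IsAlgClosed.exists_pow_nat_eq g.det (n := Fintype.card n) Fintype.card_pos
  have hwn : ‖w‖ = 1 := by
    rw [← hw, norm_pow] at hdet
    exact (pow_eq_one_iff_of_nonneg (norm_nonneg w) Fintype.card_ne_zero).mp hdet
  have hzn : ‖w⁻¹‖ = 1 := by rw [norm_inv, hwn, inv_one]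
  have hz : star w⁻¹ * w⁻¹ = 1 := by
    rw [Complex.star_def, Complex.conj_mul', hzn]; simp
  refine ⟨w⁻¹, hz, mem_specialUnitaryGroup_iff.mpr ⟨?_, ?_⟩⟩
  · rw [mem_unitaryGroup_iff', star_smul, Matrix.smul_mul, Matrix.mul_smul, smul_smul, hz, one_smul,
      mem_unitaryGroup_iff'.mp hg]
  · rw [det_smul, ← hw, ← mul_pow, inv_mul_cancel₀ (norm_ne_zero_iff.mp (by simp [hwn])), one_pow]

lemma haarCorr_conj [μ.IsMulLeftInvariant] {g : Matrix n n ℂ} (hg : g ∈ unitaryGroup n ℂ)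
    (A A' : Matrix n n ℂ) :
    haarCorr μ W j k (star g * A * g) (star g * A' * g) = haarCorr μ W j k A A' := by
  obtain ⟨z, hz, hzg⟩ := exists_smul_mem_specialUnitaryGroup hg
  have hA : ∀ (A U : Matrix n n ℂ), star (U * W) * (star g * A * g) * (U * W) =
      star (z • g * U * W) * A * (z • g * U * W) := by
    intro A U
    simp only [star_mul, star_smul, Matrix.smul_mul, Matrix.mul_smul, smul_smul, mul_comm z, hz,
      one_smul, mul_assoc]
  rw [haarCorr, haarCorr]
  simp_rw [hA]
  let G : specialUnitaryGroup n ℂ := ⟨z • g, hzg⟩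
  have hmeas : Measurable fun U : specialUnitaryGroup n ℂ => G * U := by
    refine Measurable.subtype_mk ?_
    have : Continuous fun U : Matrix n n ℂ => z • g * U := by fun_prop
    exact this.measurable.comp measurable_subtype_coe
  have hmap : μ.map (fun U => G * U) = μ := Measure.IsMulLeftInvariant.map_mul_left_eq_self G
  conv_rhs => rw [← hmap]
  rw [integral_map hmeas.aemeasurable]
  · rfl
  · exact ((continuous_mul_star_matrixElement W j k A A').measurable.comp
      measurable_subtype_coe).aestronglyMeasurable

lemma haarCorr_one_right (hW : W ∈ unitaryGroup n ℂ) (hjk : j ≠ k) (A : Matrix n n ℂ) :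
    haarCorr μ W j k A 1 = 0 := by
  rw [haarCorr]
  refine integral_eq_zero_of_ae (Filter.Eventually.of_forall fun U => ?_)
  have hU : star (U.1 * W) * (U.1 * W) = 1 :=
    mem_unitaryGroup_iff'.mp (mul_mem U.2.1 hW)
  simp only [mul_one, hU, one_apply_ne hjk, star_zero, mul_zero, Pi.zero_apply]

lemma haarCorr_self (A : Matrix n n ℂ) :
    haarCorr μ W j k A A = ((∫ U, ‖(star (U.1 * W) * A * (U.1 * W)) j k‖ ^ 2 ∂μ : ℝ) : ℂ) := by
  rw [haarCorr]
  refine Eq.trans ?_ integral_ofReal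
  congr 1
  ext U
  rw [Complex.star_def, Complex.mul_conj']
  push_cast
  rfl

lemma sum_haarCorr_single [IsProbabilityMeasure μ] (hW : W ∈ unitaryGroup n ℂ) :
    ∑ a, ∑ b, haarCorr μ W j k (single a b 1) (single a b 1) = 1 := by
  simp only [haarCorr]
  have h1 : ∀ a : n, ∑ b : n, ∫ U : specialUnitaryGroup n ℂ, (star (U.1 * W) * single a b (1 : ℂ) * (U.1 * W)) j k *
      star ((star (U.1 * W) * single a b (1 : ℂ) * (U.1 * W)) j k) ∂μ =
      ∫ U : specialUnitaryGroup n ℂ, ∑ b : n, (star (U.1 * W) * single a b (1 : ℂ) * (U.1 * W)) j k *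
      star ((star (U.1 * W) * single a b (1 : ℂ) * (U.1 * W)) j k) ∂μ := fun a =>
    (integral_finsetSum _ fun b _ => integrable_haarCorr _ _).symm
  simp_rw [h1]
  rw [← integral_finsetSum _ fun a _ => integrable_finsetSum _ fun b _ => integrable_haarCorr _ _]
  refine (integral_congr_ae (g := fun _ => (1 : ℂ))
    (Filter.Eventually.of_forall fun U => ?_)).trans (by simp)
  have hU : star (U.1 * W) * (U.1 * W) = 1 :=
    mem_unitaryGroup_iff'.mp (mul_mem U.2.1 hW)
  have hcol : ∀ i, ∑ a, star ((U.1 * W) a i) * (U.1 * W) a i = 1 := by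
    intro i
    have := congrFun (congrFun hU i) i
    rwa [Matrix.mul_apply, one_apply_eq] at this
  have he : ∀ (U : specialUnitaryGroup n ℂ) (a b : n), (star (U.1 * W) * single a b (1 : ℂ) * (U.1 * W)) j k =
      star ((U.1 * W) a j) * (U.1 * W) b k := by
    intro U a b
    generalize U.1 * W = V
    rw [mul_assoc, Matrix.mul_apply, Finset.sum_eq_single a]
    · simp
    · intro c _ hc
      simp [single_mul_apply_of_ne, hc]
    · simp
  simp only [he]
  calc ∑ a, ∑ b, star ((U.1 * W) a j) * (U.1 * W) b k *
        star (star ((U.1 * W) a j) * (U.1 * W) b k)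
      = (∑ a, star ((U.1 * W) a j) * (U.1 * W) a j) *
          ∑ b, star ((U.1 * W) b k) * (U.1 * W) b k := by
        rw [Finset.sum_mul_sum]
        refine Finset.sum_congr rfl fun a _ => Finset.sum_congr rfl fun b _ => ?_
        rw [star_mul, star_star]
        ring
    _ = 1 := by rw [hcol, hcol, one_mul]

lemma haarCorr_single_perm [μ.IsMulLeftInvariant] (σ : Equiv.Perm n) (a b : n) :
    haarCorr μ W j k (single (σ a) (σ a) 1) (single (σ b) (σ b) 1) =
      haarCorr μ W j k (single a a 1) (single b b 1) := by
  have hg : σ.permMatrix ℂ ∈ unitaryGroup n ℂ := by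
    rw [mem_unitaryGroup_iff', star_eq_conjTranspose, conjTranspose_permMatrix, ← permMatrix_mul,
      mul_inv_cancel, permMatrix_one]
  have hs : ∀ a, star (σ.permMatrix ℂ) * single a a 1 * σ.permMatrix ℂ =
      single (σ a) (σ a) 1 := by
    intro a
    rw [star_eq_conjTranspose, conjTranspose_permMatrix, PEquiv.toMatrix_toPEquiv_mul,
      PEquiv.mul_toMatrix_toPEquiv]
    ext x y
    simp [single_apply, Equiv.eq_symm_apply, ← Equiv.Perm.inv_def]
  rw [← hs a, ← hs b, haarCorr_conj hg]

lemma exists_haarCorr_single_eq [IsProbabilityMeasure μ] [μ.IsMulLeftInvariant]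
    (hW : W ∈ unitaryGroup n ℂ) (hjk : j ≠ k) :
    ∃ α : ℂ, ∀ a b, ((Fintype.card n : ℂ) - 1) *
      haarCorr μ W j k (single a a 1) (single b b 1) =
        α * (if a = b then (Fintype.card n : ℂ) - 1 else -1) := by
  refine ⟨haarCorr μ W j k (single j j 1) (single j j 1), fun a b => ?_⟩
  have hdiag : ∀ a, haarCorr μ W j k (single a a 1) (single a a 1) =
      haarCorr μ W j k (single j j 1) (single j j 1) := by
    intro a
    simpa using haarCorr_single_perm (μ := μ) (W := W) (j := j) (k := k) (Equiv.swap j a) j j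
  split_ifs with hab
  · rw [← hab, hdiag, mul_comm]
  have hoff : ∀ c ∈ Finset.univ.erase a,
      haarCorr μ W j k (single a a 1) (single c c 1) =
        haarCorr μ W j k (single a a 1) (single b b 1) := by
    intro c hc
    have := haarCorr_single_perm (μ := μ) (W := W) (j := j) (k := k) (Equiv.swap b c) a b
    rwa [Equiv.swap_apply_left, Equiv.swap_apply_of_ne_of_ne hab
      (Finset.ne_of_mem_erase hc).symm] at this
  have hrow : ∑ c, haarCorr μ W j k (single a a 1) (single c c 1) = 0 := by
    have h1 : (1 : Matrix n n ℂ) = ∑ c, (1 : ℂ) • single c c (1 : ℂ) := by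
      ext x y
      simp [Matrix.sum_apply, single_apply, one_apply, ite_and]
    rw [← haarCorr_one_right hW hjk (μ := μ) (single a a 1), h1, haarCorr_sum_right]
    simp
  rw [← Finset.add_sum_erase _ _ (Finset.mem_univ a), hdiag, Finset.sum_congr rfl hoff,
    Finset.sum_const, Finset.card_erase_of_mem (Finset.mem_univ a), Finset.card_univ,
    nsmul_eq_mul, Nat.cast_sub (Fintype.card_pos_iff.mpr ⟨a⟩), Nat.cast_one] at hrow
  linear_combination hrow

lemma exists_haarCorr_hermitian_eq [IsProbabilityMeasure μ] [μ.IsMulLeftInvariant]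
    (hW : W ∈ unitaryGroup n ℂ) (hjk : j ≠ k) :
    ∃ α : ℂ, ∀ A : Matrix n n ℂ, A.IsHermitian → ((Fintype.card n : ℂ) - 1) *
      haarCorr μ W j k A A = α * (Fintype.card n * (A * A).trace - A.trace ^ 2) := by
  obtain ⟨α, hα⟩ := exists_haarCorr_single_eq (μ := μ) hW hjk
  refine ⟨α, fun A hA => ?_⟩
  set g : Matrix n n ℂ := hA.eigenvectorUnitary.1 with hg
  have hgm : g ∈ unitaryGroup n ℂ := hA.eigenvectorUnitary.2
  have hgs : star g * g = 1 := mem_unitaryGroup_iff'.mp hgm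
  set D : Matrix n n ℂ := diagonal fun i => (hA.eigenvalues i : ℂ) with hD
  have hspec : A = g * D * star g := by
    conv_lhs => rw [hA.spectral_theorem, Unitary.conjStarAlgAut_apply]
    rfl
  have hDA : star g * A * g = D := by
    rw [hspec]
    calc star g * (g * D * star g) * g = (star g * g) * D * (star g * g) := by
          simp only [mul_assoc]
      _ = D := by rw [hgs, one_mul, mul_one]
  have htr : A.trace = ∑ i, (hA.eigenvalues i : ℂ) := by
    rw [← trace_diagonal, ← hD, ← hDA, trace_mul_comm, ← mul_assoc, mem_unitaryGroup_iff.mp hgm,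
      one_mul]
  have htr2 : (A * A).trace = ∑ i, (hA.eigenvalues i : ℂ) ^ 2 := by
    have hDD : D * D = star g * (A * A) * g := by
      rw [← hDA]
      calc star g * A * g * (star g * A * g) = star g * A * (g * star g) * A * g := by
            simp only [mul_assoc]
        _ = _ := by rw [mem_unitaryGroup_iff.mp hgm, mul_one]; simp only [mul_assoc]
    have hDD' : (D * D).trace = (A * A).trace := by
      rw [hDD, trace_mul_comm, ← mul_assoc, mem_unitaryGroup_iff.mp hgm, one_mul]
    rw [← hDD', hD, diagonal_mul_diagonal, trace_diagonal]
    simp only [pow_two]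
  have hDsum : D = ∑ a, (hA.eigenvalues a : ℂ) • single a a (1 : ℂ) := by
    ext x y
    simp [hD, Matrix.sum_apply, single_apply, diagonal_apply, ite_and]
  rw [← haarCorr_conj hgm, hDA, hDsum, haarCorr_sum_left]
  simp_rw [haarCorr_sum_right]
  have hterm : ∀ a b, ((Fintype.card n : ℂ) - 1) * ((hA.eigenvalues a : ℂ) *
      (star (hA.eigenvalues b : ℂ) * haarCorr μ W j k (single a a 1) (single b b 1))) =
      α * ((if a = b then (Fintype.card n : ℂ) * (hA.eigenvalues a : ℂ) ^ 2 else 0) -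
        (hA.eigenvalues a : ℂ) * (hA.eigenvalues b : ℂ)) := by
    intro a b
    have := hα a b
    rw [Complex.star_def, Complex.conj_ofReal]
    split_ifs at this ⊢ with hab
    · subst hab
      linear_combination ((hA.eigenvalues a : ℂ) * (hA.eigenvalues a : ℂ)) * this
    · linear_combination ((hA.eigenvalues a : ℂ) * (hA.eigenvalues b : ℂ)) * this
  simp_rw [Finset.mul_sum, hterm]
  simp_rw [← Finset.mul_sum, Finset.sum_sub_distrib]
  rw [htr, htr2, sq (∑ i, _), Finset.sum_mul_sum]
  simp [Finset.mul_sum]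

lemma haarCorr_parallelogram [IsProbabilityMeasure μ] (A B : Matrix n n ℂ) :
    haarCorr μ W j k (A + B) (A + B) +
      haarCorr μ W j k (Complex.I • (A - B)) (Complex.I • (A - B)) =
      2 * (haarCorr μ W j k A A + haarCorr μ W j k B B) := by
  simp only [haarCorr]
  rw [← integral_add (integrable_haarCorr _ _) (integrable_haarCorr _ _),
    ← integral_add (integrable_haarCorr _ _) (integrable_haarCorr _ _), ← integral_const_mul]
  congr 1
  ext U
  generalize U.1 * W = V
  simp only [mul_add, add_mul, mul_sub, sub_mul, Matrix.add_apply, Matrix.sub_apply,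
    Matrix.mul_smul, Matrix.smul_mul, Matrix.smul_apply, smul_eq_mul, star_add, star_sub, star_mul,
    Complex.star_def, Complex.conj_I]
  linear_combination (-((star V * A * V) j k - (star V * B * V) j k) *
    ((starRingEnd ℂ) ((star V * A * V) j k) - (starRingEnd ℂ) ((star V * B * V) j k))) *
      Complex.I_sq

/-- The second moment of an off-diagonal matrix element of a traceless Hermitian matrix in a
Haar-random orthonormal basis. -/
lemma haarCorr_self_of_trace_eq_zero [IsProbabilityMeasure μ] [μ.IsMulLeftInvariant]
    (hW : W ∈ unitaryGroup n ℂ) (hjk : j ≠ k) {A : Matrix n n ℂ} (hA : A.IsHermitian)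
    (htr : A.trace = 0) :
    haarCorr μ W j k A A = (A * A).trace / ((Fintype.card n : ℂ) ^ 2 - 1) := by
  obtain ⟨α, hα⟩ := exists_haarCorr_hermitian_eq (μ := μ) hW hjk
  set D : ℂ := (Fintype.card n : ℂ) with hD
  have hcard : 1 < Fintype.card n := Fintype.one_lt_card_iff.mpr ⟨j, k, hjk⟩
  have hpair : ∀ a b, (D - 1) * (haarCorr μ W j k (single a b 1) (single a b 1) +
      haarCorr μ W j k (single b a 1) (single b a 1)) =
        2 * α * (D - if a = b then 1 else 0) := by
    intro a b
    have hX : (single a b (1 : ℂ) + single b a 1).IsHermitian := by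
      simp [Matrix.IsHermitian, add_comm]
    have hY : (Complex.I • (single a b (1 : ℂ) - single b a 1)).IsHermitian := by
      simp [Matrix.IsHermitian, ← smul_neg]
    have h1 := hα _ hX
    have h2 := hα _ hY
    have h3 := haarCorr_parallelogram (μ := μ) (W := W) (j := j) (k := k)
      (single a b (1 : ℂ)) (single b a 1)
    have hXY : (D * ((single a b (1 : ℂ) + single b a 1) * (single a b 1 + single b a 1)).trace -
        (single a b (1 : ℂ) + single b a 1).trace ^ 2) +
        (D * ((Complex.I • (single a b (1 : ℂ) - single b a 1)) *
          (Complex.I • (single a b (1 : ℂ) - single b a 1))).trace -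
        (Complex.I • (single a b (1 : ℂ) - single b a 1)).trace ^ 2) =
        4 * (D - if a = b then 1 else 0) := by
      by_cases hab : a = b
      · subst hab
        simp [add_mul, mul_add, trace_add]
        ring
      · simp [add_mul, mul_add, sub_mul, mul_sub, trace_add, trace_sub, hab, Ne.symm hab]
        ring
    linear_combination ((1 - D) * h3 + h1 + h2 + α * hXY) / 2
  have hsum : 2 * (D - 1) = 2 * α * (D ^ 3 - D) := by
    have h1 := sum_haarCorr_single (μ := μ) (j := j) (k := k) hW
    have h2 : ∑ a, ∑ b, haarCorr μ W j k (single b a 1) (single b a 1) = 1 := by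
      rw [Finset.sum_comm]; exact h1
    calc 2 * (D - 1) = ∑ a, ∑ b, (D - 1) * (haarCorr μ W j k (single a b 1) (single a b 1) +
          haarCorr μ W j k (single b a 1) (single b a 1)) := by
          simp_rw [← Finset.mul_sum, Finset.sum_add_distrib]
          rw [h1, h2]; ring
      _ = _ := by
          simp_rw [hpair, ← Finset.mul_sum, Finset.sum_sub_distrib]
          simp only [Finset.sum_const, Finset.card_univ, nsmul_eq_mul, ← hD, Finset.sum_ite_eq,
            Finset.mem_univ, if_true]
          ring
  have hD0 : D ≠ 0 := by rw [hD]; exact_mod_cast (by omega : Fintype.card n ≠ 0)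
  have hD1 : D - 1 ≠ 0 := by
    rw [sub_ne_zero, hD]; exact_mod_cast (by omega : Fintype.card n ≠ 1)
  have hDp : D + 1 ≠ 0 := by rw [hD]; exact_mod_cast (by omega : Fintype.card n + 1 ≠ 0)
  have hα1 : α * D * (D + 1) = 1 := by
    refine mul_left_cancel₀ hD1 ?_
    linear_combination -hsum / 2
  have h := hα A hA
  rw [htr] at h
  rw [eq_div_iff (by rw [show D ^ 2 - 1 = (D - 1) * (D + 1) by ring]; exact mul_ne_zero hD1 hDp)]
  linear_combination (D + 1) * h + (A * A).trace * hα1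

end HaarAverage

section AverageFisherInformation

variable {n : Type*} [Fintype n] [DecidableEq n]

/-- The Haar average of the quantum Fisher information of a random isospectral state for a
traceless Hamiltonian. -/
lemma integral_QFI_conj {ρ H : Matrix n n ℂ} (hρ : ρ.IsHermitian) (hH : H.IsHermitian)
    (htr : H.trace = 0) (μ : Measure (specialUnitaryGroup n ℂ)) [IsProbabilityMeasure μ]
    [μ.IsMulLeftInvariant] :
    ∫ U, QFI (U.1 * ρ * star U.1) H ∂μ =
      2 * ((H * H).trace.re / ((Fintype.card n : ℝ) ^ 2 - 1)) *
        ∑ j, ∑ k, qfiWeight (hρ.eigenvalues j) (hρ.eigenvalues k) := by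
  set W : Matrix n n ℂ := hρ.eigenvectorUnitary.1 with hWdef
  have hW : W ∈ unitaryGroup n ℂ := hρ.eigenvectorUnitary.2
  have hspec : ρ = W * diagonal (fun i => (hρ.eigenvalues i : ℂ)) * star W := by
    conv_lhs => rw [hρ.spectral_theorem, Unitary.conjStarAlgAut_apply]
    rfl
  have hQ : ∀ U : specialUnitaryGroup n ℂ, QFI (U.1 * ρ * star U.1) H =
      2 * ∑ j, ∑ k, qfiWeight (hρ.eigenvalues j) (hρ.eigenvalues k) *
        ‖(star (U.1 * W) * H * (U.1 * W)) j k‖ ^ 2 := by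
    intro U
    refine QFI_eq_sum_of_eq_conj_diagonal H (mem_unitaryGroup_iff'.mp (mul_mem U.2.1 hW)) ?_
    calc U.1 * ρ * star U.1
        = U.1 * (W * diagonal (fun i => (hρ.eigenvalues i : ℂ)) * star W) * star U.1 := by
          rw [← hspec]
      _ = _ := by simp only [star_mul, mul_assoc]
  have hint : ∀ j k, Integrable (fun U : specialUnitaryGroup n ℂ =>
      ‖(star (U.1 * W) * H * (U.1 * W)) j k‖ ^ 2) μ := by
    intro j k
    refine (integrable_haarCorr (μ := μ) (W := W) (j := j) (k := k) H H).re.congr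
      (Filter.Eventually.of_forall fun U => ?_)
    simp only [Complex.star_def, Complex.mul_conj']
    exact_mod_cast Complex.ofReal_re _
  have hmoment : ∀ j k, qfiWeight (hρ.eigenvalues j) (hρ.eigenvalues k) *
      ∫ U, ‖(star (U.1 * W) * H * (U.1 * W)) j k‖ ^ 2 ∂μ =
      qfiWeight (hρ.eigenvalues j) (hρ.eigenvalues k) *
        ((H * H).trace.re / ((Fintype.card n : ℝ) ^ 2 - 1)) := by
    intro j k
    by_cases hjk : j = k
    · rw [hjk, qfiWeight_self, zero_mul, zero_mul]
    congr 1
    have := congrArg Complex.re (haarCorr_self_of_trace_eq_zero (μ := μ) hW hjk hH htr)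
    rw [haarCorr_self, Complex.ofReal_re] at this
    rw [this, ← Complex.div_ofReal_re]
    push_cast
    rfl
  simp_rw [hQ]
  rw [integral_const_mul, integral_finsetSum _ fun j _ => integrable_finsetSum _ fun k _ =>
    (hint j k).const_mul _]
  simp_rw [integral_finsetSum _ fun k _ => (hint _ k).const_mul _, integral_const_mul, hmoment,
    ← Finset.sum_mul]
  ring

end AverageFisherInformation

/-- the Haar average of the QFI of random isospectral states of `N`
distinguishable particles:
`E_{U∼μ(d^N)} F(UρU†, H_N) = (4N·tr(h²)/d)·(d^N/(d^N+1))·Λ(p)`. -/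
theorem average_qfi_distinguishable (d N : ℕ) (hd : 2 ≤ d) (hN : 1 ≤ N)
    (h : Matrix (Fin d) (Fin d) ℂ) (hherm : h.IsHermitian) (htrh : h.trace = 0)
    (ρ : Matrix (Fin N → Fin d) (Fin N → Fin d) ℂ) (hρ : ρ.PosSemidef) (htrρ : ρ.trace = 1)
    (μ : Measure (Matrix.specialUnitaryGroup (Fin N → Fin d) ℂ))
    [IsProbabilityMeasure μ] [μ.IsMulLeftInvariant] :
    ∫ U, QFI (U.1 * ρ * star U.1) (localHam d N h) ∂μ =
      (4 * N * (Matrix.trace (h * h)).re / d) * ((d : ℝ) ^ N / ((d : ℝ) ^ N + 1)) *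
        ((1 / (2 * ((d : ℝ) ^ N - 1))) *
          ∑ i, ∑ j,
            (if hρ.1.eigenvalues i + hρ.1.eigenvalues j = 0 then 0
             else (hρ.1.eigenvalues i - hρ.1.eigenvalues j) ^ 2 /
               (hρ.1.eigenvalues i + hρ.1.eigenvalues j))) := by
  rw [integral_QFI_conj hρ.1 (isHermitian_localHam hherm) (trace_localHam htrh),
    trace_localHam_mul_self htrh]
  simp only [qfiWeight]
  set S : ℝ := ∑ i, ∑ j,
            (if hρ.1.eigenvalues i + hρ.1.eigenvalues j = 0 then 0
             else (hρ.1.eigenvalues i - hρ.1.eigenvalues j) ^ 2 /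
               (hρ.1.eigenvalues i + hρ.1.eigenvalues j))
  have hre : ((N : ℂ) * ((d : ℂ) ^ (N - 1) * (h * h).trace)).re =
      N * ((d : ℝ) ^ (N - 1) * (h * h).trace.re) := by
    have : (N : ℂ) * ((d : ℂ) ^ (N - 1) * (h * h).trace) =
        ((N * (d : ℝ) ^ (N - 1) : ℝ) : ℂ) * (h * h).trace := by push_cast; ring
    rw [this, Complex.re_ofReal_mul, mul_assoc]
  have hd1 : (1 : ℝ) < d := by exact_mod_cast hd
  have hDgt : (1 : ℝ) < (d : ℝ) ^ N := one_lt_pow₀ hd1 (by omega)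
  have hpow : (d : ℝ) ^ N = d * (d : ℝ) ^ (N - 1) := by
    rw [← pow_succ', Nat.sub_add_cancel hN]
  have hd0 : (d : ℝ) ≠ 0 := by positivity
  rw [hre, Fintype.card_fun, Fintype.card_fin, Fintype.card_fin, Nat.cast_pow]
  have e1 : (d : ℝ) ^ N - 1 ≠ 0 := by linarith
  have e2 : (d : ℝ) ^ N + 1 ≠ 0 := by linarith
  have e3 : ((d : ℝ) ^ N) ^ 2 - 1 = ((d : ℝ) ^ N - 1) * ((d : ℝ) ^ N + 1) := by ring
  rw [e3]
  rw [hpow] at e1 e2 ⊢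
  field_simp
  ring

end Paper
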